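/- arXiv:2204.01315 — 2 statements merged into one kernel-verified Lean document; each statement's English description precedes it below -/
import Mathlib

section
/- Let the G-ADMM-M iterates be given, assume (1/2)Σ̂_{f1} + S is positive semidefinite, and assume that for each k there exists a self-adjoint positive semidefinite operator Γ^k on X with Σ̂_{f1} − Γ^k positive semidefinite and ∇f1(x̃^{k+1}) − ∇f1(x̃^k) = Γ^k(x̃^{k+1} − x̃^k). Then for every k ≥ 1, σ(2−ρ)‖A*x^k + B*y^k − c‖² ≥ σ(2−ρ)‖A*x^{k+1} + B*y^k − c‖² + ((2−ρ)²/ρ)‖x^{k+1} − x^k‖²_{Σ̂_{f1}+S+σAA*} − (2−ρ)‖x̃^k − x^k‖²_{Σ̂_{f1}+S}. -/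
open scoped InnerProductSpace

/-- The quadratic form `‖u‖_G² := ⟪u, G u⟫` associated with a linear operator `G`. -/
noncomputable def qf {E : Type*} [NormedAddCommGroup E] [InnerProductSpace ℝ E]
    (G : E →L[ℝ] E) (u : E) : ℝ := ⟪u, G u⟫_ℝ

/-- `v` is a subgradient of the convex function `f` at `x`. -/
def IsSubgrad {E : Type*} [NormedAddCommGroup E] [InnerProductSpace ℝ E]
    (f : E → ℝ) (v x : E) : Prop := ∀ w, f x + ⟪v, w - x⟫_ℝ ≤ f w

theorem IsSubgrad.inner_sub_nonneg {E : Type*} [NormedAddCommGroup E] [InnerProductSpace ℝ E]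
    {f : E → ℝ} {v v' x x' : E} (h : IsSubgrad f v x) (h' : IsSubgrad f v' x') :
    0 ≤ ⟪v' - v, x' - x⟫_ℝ := by
  have h₁ := h x'
  have h₂ := h' x
  rw [← neg_sub x' x, inner_neg_right] at h₂
  rw [inner_sub_left]
  linarith

/-- If `0 ≤ Γ ≤ H` with both self-adjoint, then `2 ⟪(H - Γ) p, d⟫ ≤ ‖d‖_H² + ‖p‖_H²`. -/
theorem two_mul_inner_sub_le_qf_add_qf {E : Type*} [NormedAddCommGroup E] [InnerProductSpace ℝ E]
    (H Γ : E →L[ℝ] E) (hH : ∀ u v : E, ⟪H u, v⟫_ℝ = ⟪u, H v⟫_ℝ)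
    (hΓ : ∀ u v : E, ⟪Γ u, v⟫_ℝ = ⟪u, Γ v⟫_ℝ) (hΓ0 : ∀ u : E, 0 ≤ ⟪u, Γ u⟫_ℝ)
    (hΓH : ∀ u : E, 0 ≤ ⟪u, (H - Γ) u⟫_ℝ) (p d : E) :
    2 * ⟪(H - Γ) p, d⟫_ℝ ≤ qf H d + qf H p := by
  have h := hΓH (d - p)
  have h₁ := hΓ0 d
  have h₂ := hΓ0 p
  have e₁ : ⟪d, H p⟫_ℝ = ⟪p, H d⟫_ℝ := by rw [← hH, real_inner_comm]
  have e₂ : ⟪d, Γ p⟫_ℝ = ⟪p, Γ d⟫_ℝ := by rw [← hΓ, real_inner_comm]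
  simp only [qf, sub_apply, map_sub, inner_sub_left, inner_sub_right, hH, hΓ]
    at h ⊢
  linarith

theorem stmt_14 {X Y Z : Type*}
    [NormedAddCommGroup X] [InnerProductSpace ℝ X] [FiniteDimensional ℝ X]
    [NormedAddCommGroup Y] [InnerProductSpace ℝ Y] [FiniteDimensional ℝ Y]
    [NormedAddCommGroup Z] [InnerProductSpace ℝ Z] [FiniteDimensional ℝ Z]
    (f1 f2 : X → ℝ) (h1 h2 : Y → ℝ)
    (hf1c : ConvexOn ℝ Set.univ f1) (hf1d : Differentiable ℝ f1)
    (hh1c : ConvexOn ℝ Set.univ h1) (hh1d : Differentiable ℝ h1)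
    (hf2c : ConvexOn ℝ Set.univ f2) (hh2c : ConvexOn ℝ Set.univ h2)
    (Sfh : X →L[ℝ] X) (Shh : Y →L[ℝ] Y)
    (hSfhsa : ∀ u v : X, ⟪Sfh u, v⟫_ℝ = ⟪u, Sfh v⟫_ℝ)
    (hShhsa : ∀ u v : Y, ⟪Shh u, v⟫_ℝ = ⟪u, Shh v⟫_ℝ)
    (hSfhpsd : ∀ u : X, 0 ≤ ⟪u, Sfh u⟫_ℝ) (hShhpsd : ∀ u : Y, 0 ≤ ⟪u, Shh u⟫_ℝ)
    (A : Z →L[ℝ] X) (As : X →L[ℝ] Z) (B : Z →L[ℝ] Y) (Bs : Y →L[ℝ] Z)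
    (hA : ∀ (zz : Z) (xx : X), ⟪A zz, xx⟫_ℝ = ⟪zz, As xx⟫_ℝ)
    (hB : ∀ (zz : Z) (yy : Y), ⟪B zz, yy⟫_ℝ = ⟪zz, Bs yy⟫_ℝ)
    (c : Z) (σ ρ : ℝ) (hσ : 0 < σ) (hρ : ρ ∈ Set.Ioo (0 : ℝ) 2)
    (S : X →L[ℝ] X) (T : Y →L[ℝ] Y)
    (hSsa : ∀ u v : X, ⟪S u, v⟫_ℝ = ⟪u, S v⟫_ℝ)
    (hTsa : ∀ u v : Y, ⟪T u, v⟫_ℝ = ⟪u, T v⟫_ℝ)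
    (hSpsd : ∀ u : X, 0 ≤ ⟪u, S u⟫_ℝ) (hTpsd : ∀ u : Y, 0 ≤ ⟪u, T u⟫_ℝ)
    (x xt : ℕ → X) (y yt : ℕ → Y) (z zt : ℕ → Z)
    (hfocx : ∀ k, IsSubgrad f2
      (-gradient f1 (xt k) - (Sfh + S) (x k - xt k) - A (z k)) (x k))
    (hzdef : ∀ k, z k = zt k + σ • (As (x k) + Bs (yt k) - c))
    (hfocy : ∀ k, IsSubgrad h2
      (-gradient h1 (yt k) - (Shh + T) (y k - yt k) -
        B (z k + σ • (As (x k) + Bs (y k) - c))) (y k))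
    (hxt : ∀ k, xt (k + 1) = xt k + ρ • (x k - xt k))
    (hyt : ∀ k, yt (k + 1) = yt k + ρ • (y k - yt k))
    (hzt : ∀ k, zt (k + 1) = zt k + ρ • (z k - zt k))
    (hhalf : ∀ u : X, 0 ≤ ⟪u, ((1 / 2 : ℝ) • Sfh + S) u⟫_ℝ)
    (Γ : ℕ → X →L[ℝ] X)
    (hΓsa : ∀ k, ∀ u v : X, ⟪Γ k u, v⟫_ℝ = ⟪u, Γ k v⟫_ℝ)
    (hΓpsd : ∀ k, ∀ u : X, 0 ≤ ⟪u, Γ k u⟫_ℝ)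
    (hΓle : ∀ k, ∀ u : X, 0 ≤ ⟪u, (Sfh - Γ k) u⟫_ℝ)
    (hΓgrad : ∀ k,
      gradient f1 (xt (k + 1)) - gradient f1 (xt k) = Γ k (xt (k + 1) - xt k)) :
    ∀ k ≥ 1,
      σ * (2 - ρ) * ‖As (x k) + Bs (y k) - c‖ ^ 2 ≥
        σ * (2 - ρ) * ‖As (x (k + 1)) + Bs (y k) - c‖ ^ 2 +
        ((2 - ρ) ^ 2 / ρ) *
          qf (Sfh + S + σ • (A.comp As)) (x (k + 1) - x k) -
        (2 - ρ) * qf (Sfh + S) (xt k - x k) := by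
  intro k _
  obtain ⟨hρ0, hρ2⟩ := hρ
  have hmono := (hfocx k).inner_sub_nonneg (hfocx (k + 1))
  set d := x (k + 1) - x k with hd
  set p := x k - xt k with hp
  set r := As (x k) + Bs (y k) - c with hr
  have hz : z (k + 1) - z k = σ • (As d + ρ • r) := by
    rw [hzdef (k + 1), hzt k, hyt k, hzdef k, hd, hr]
    simp only [map_add, map_sub, map_smul]
    module
  have hx : x (k + 1) - xt (k + 1) = d + (1 - ρ) • p := by
    rw [hxt k, hd, hp]
    module
  have hg : gradient f1 (xt (k + 1)) = gradient f1 (xt k) + ρ • Γ k p := by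
    rw [← sub_eq_iff_eq_add', hΓgrad k, hxt k, add_sub_cancel_left, map_smul]
  have hv : (-gradient f1 (xt (k + 1)) - (Sfh + S) (x (k + 1) - xt (k + 1)) - A (z (k + 1))) -
      (-gradient f1 (xt k) - (Sfh + S) p - A (z k)) =
      ρ • (Sfh + S - Γ k) p - (Sfh + S) d - A (σ • (As d + ρ • r)) := by
    rw [hg, hx, ← hz]
    simp only [add_apply, sub_apply, map_add,
      map_sub, map_smul]
    module
  have hquad : qf (Sfh + S + σ • (A.comp As)) d = qf (Sfh + S) d + σ * ‖As d‖ ^ 2 := by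
    have : ⟪d, A (As d)⟫_ℝ = ‖As d‖ ^ 2 := by
      rw [real_inner_comm, hA, real_inner_self_eq_norm_sq]
    rw [← this]
    simp only [qf, add_apply, smul_apply, ContinuousLinearMap.comp_apply, inner_add_right,
      real_inner_smul_right]
  have hcross := two_mul_inner_sub_le_qf_add_qf (Sfh + S) (Γ k)
    (fun u v => by simp only [add_apply, inner_add_left, inner_add_right, hSfhsa, hSsa])
    (hΓsa k) (hΓpsd k)
    (fun u => by
      rw [add_sub_right_comm, add_apply, inner_add_right]
      exact add_nonneg (hΓle k u) (hSpsd u)) p d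
  have hres : As (x (k + 1)) + Bs (y k) - c = r + As d := by
    rw [hr, hd, map_sub]
    abel
  have hneg : qf (Sfh + S) (xt k - x k) = qf (Sfh + S) p := by
    rw [← neg_sub (x k) (xt k), qf, qf, map_neg, inner_neg_neg]
  rw [hv, inner_sub_left, inner_sub_left, hA, real_inner_smul_left, real_inner_smul_left,
    inner_add_left, real_inner_smul_left, real_inner_self_eq_norm_sq,
    real_inner_comm d ((Sfh + S) d)] at hmono
  change 0 ≤ _ - qf (Sfh + S) d - _ at hmono
  rw [hres, hneg, hquad, norm_add_sq_real]
  generalize ⟪(Sfh + S - Γ k) p, d⟫_ℝ = m at *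
  generalize qf (Sfh + S) d = D at *
  generalize qf (Sfh + S) p = P at *
  generalize ⟪r, As d⟫_ℝ = s at *
  have hdiv : 2 / ρ * (D + σ * ‖As d‖ ^ 2) ≤ 2 * m - 2 * σ * s := by
    rw [div_mul_eq_mul_div, div_le_iff₀ hρ0]
    linarith
  have hfac : (2 - ρ) ^ 2 / ρ = (2 - ρ) * (2 / ρ - 1) := by
    field_simp
  rw [hfac]
  have := mul_nonneg (sub_nonneg.2 hρ2.le)
    (show 0 ≤ -2 * σ * s - σ * ‖As d‖ ^ 2 - (2 / ρ - 1) * (D + σ * ‖As d‖ ^ 2) + P by linarith)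
  linarith
end

section
/- Let (x̄, ȳ, z̄) be a KKT point, let the G-ADMM-M iterates be given, assume (1/2)Σ̂_{f1} + S is positive semidefinite, and assume for each k there exists a self-adjoint positive semidefinite operator Γ^k with Σ̂_{f1} − Γ^k positive semidefinite and ∇f1(x̃^{k+1}) − ∇f1(x̃^k) = Γ^k(x̃^{k+1} − x̃^k). Then for every λ ∈ (0,1] and every k ≥ 1: [Ψ_k + (2−ρ)‖x̃^k − x^k‖²_{Σ̂_{f1}+S} + σ(1−λ)(2−ρ)‖A*x^k + B*y^{k−1} − c‖²] − [Ψ_{k+1} + (2−ρ)‖x̃^{k+1} − x^{k+1}‖²_{Σ̂_{f1}+S} + σ(1−λ)(2−ρ)‖A*x^{k+1} + B*y^k − c‖²] ≥ δ_k − ξ_k, where Ψ_k := (1/(σρ))‖z_e^k + σ(ρ−1)A*x_e^k‖² + σ(2−ρ)‖A*x_e^k‖² + (1/ρ)‖x̃_e^{k+1}‖²_{Σ̂_{f1}+S} + (1/ρ)‖ỹ_e^k‖²_{Σ̂_{h1}+T}, δ_k := ‖x̃^{k+1} − x^{k+1}‖²_{(1/2)Σ_{f1}} + ‖ỹ^k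 − y^k‖²_{(1/2)Σ_{h1}+(2−ρ)(Σ̂_{h1}+T)} + (1−λ)(2−ρ)‖x̃^k − x^k‖²_{Σ̂_{f1}+S} + σ(2λ−1)(2−ρ)‖A*x^{k+1} + B*y^k − c‖² + (σ(1−λ)(2−ρ)/2)‖B*(y^k − y^{k−1})‖² + (λ(2−ρ)²/ρ)‖x^{k+1} − x^k‖²_{Σ̂_{f1}+S+σAA*}, and ξ_k := ‖x̃^{k+1} − x^{k+1}‖²_{Σ̂_{f1}} + ‖ỹ^k − y^k‖²_{Σ̂_{h1}}. -/
open scoped InnerProductSpace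

section Helpers

variable {E : Type*} [NormedAddCommGroup E] [InnerProductSpace ℝ E]

lemma IsSubgrad.inner_sub_nonneg_s15 {f : E → ℝ} {v w x y : E}
    (hx : IsSubgrad f v x) (hy : IsSubgrad f w y) : 0 ≤ ⟪x - y, v - w⟫_ℝ := by
  have h₁ := hx y
  have h₂ := hy x
  rw [real_inner_comm]
  simp only [inner_sub_left, inner_sub_right] at *
  linarith

lemma qf_add_apply (G H : E →L[ℝ] E) (u : E) : qf (G + H) u = qf G u + qf H u := by
  simp [qf, inner_add_right]

lemma qf_smul_apply (r : ℝ) (G : E →L[ℝ] E) (u : E) : qf (r • G) u = r * qf G u := by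
  simp [qf, inner_smul_right]

lemma qf_sub_comm (G : E →L[ℝ] E) (u v : E) : qf G (u - v) = qf G (v - u) := by
  simp only [qf, map_sub, inner_sub_left, inner_sub_right]
  ring

lemma qf_sub_le {G : E →L[ℝ] E} (hG : ∀ u, 0 ≤ ⟪u, G u⟫_ℝ) (u v : E) :
    qf G (u - v) ≤ 2 * qf G u + 2 * qf G v := by
  have h := hG (u + v)
  simp only [qf, map_sub, map_add, inner_sub_left, inner_sub_right, inner_add_left,
    inner_add_right] at *
  linarith

/-- Three-point inequality for a gradient evaluated at a shifted point. -/
lemma le_inner_gradient_sub [CompleteSpace E] {f : E → ℝ} {L U : E →L[ℝ] E}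
    (hL : ∀ u, 0 ≤ ⟪u, L u⟫_ℝ)
    (hlow : ∀ x x' : E, (1 / 2) * qf L (x - x') ≤ f x - f x' - ⟪x - x', gradient f x'⟫_ℝ)
    (hupp : ∀ x x' : E, f x - f x' - ⟪x - x', gradient f x'⟫_ℝ ≤ (1 / 2) * qf U (x - x'))
    (x xt xb : E) :
    (1 / 4) * qf L (xt - x) - (1 / 2) * qf U (xt - x) ≤
      ⟪x - xb, gradient f xt - gradient f xb⟫_ℝ := by
  have h₁ := hlow xb xt
  have h₂ := hlow x xb
  have h₃ := hupp x xt
  have h₄ := qf_sub_le hL (xt - xb) (x - xb)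
  rw [sub_sub_sub_cancel_right] at h₄
  rw [qf_sub_comm L xb xt] at h₁
  rw [qf_sub_comm U x xt] at h₃
  simp only [inner_sub_left, inner_sub_right] at *
  linarith

lemma qf_relaxation {G : E →L[ℝ] E} (hG : ∀ u v, ⟪G u, v⟫_ℝ = ⟪u, G v⟫_ℝ)
    {ρ : ℝ} (hρ : ρ ≠ 0) (x xt xb : E) :
    (1 / ρ) * qf G (xt - xb) - (1 / ρ) * qf G (xt + ρ • (x - xt) - xb) =
      2 * ⟪x - xb, G (xt - x)⟫_ℝ + (2 - ρ) * qf G (xt - x) := by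
  have h (u v : E) : ⟪u, G v⟫_ℝ = ⟪v, G u⟫_ℝ := by rw [← hG, real_inner_comm]
  obtain ⟨e, rfl⟩ : ∃ e, xt = x + e := ⟨xt - x, by abel⟩
  obtain ⟨w, rfl⟩ : ∃ w, x = xb + w := ⟨x - xb, by abel⟩
  have h₁ : xb + w + e - xb = w + e := by abel
  have h₂ : xb + w + e + ρ • (xb + w - (xb + w + e)) - xb = w + e - ρ • e := by
    rw [show xb + w - (xb + w + e) = -e by abel, smul_neg]
    abel
  rw [h₁, h₂, add_sub_cancel_left, add_sub_cancel_left]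
  simp only [qf, map_sub, map_add, map_smul, inner_sub_left, inner_sub_right, inner_add_left,
    inner_add_right, inner_smul_left, inner_smul_right, RCLike.conj_to_real, h e w]
  field_simp
  ring

/-- Decrease of the proximal distance to a stationary point over one relaxed
linearized-proximal step. -/
lemma prox_step_le [CompleteSpace E] {f g : E → ℝ} {L U G : E →L[ℝ] E}
    (hL : ∀ u, 0 ≤ ⟪u, L u⟫_ℝ)
    (hlow : ∀ x x' : E, (1 / 2) * qf L (x - x') ≤ f x - f x' - ⟪x - x', gradient f x'⟫_ℝ)
    (hupp : ∀ x x' : E, f x - f x' - ⟪x - x', gradient f x'⟫_ℝ ≤ (1 / 2) * qf U (x - x'))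
    (hG : ∀ u v, ⟪G u, v⟫_ℝ = ⟪u, G v⟫_ℝ) {ρ : ℝ} (hρ : ρ ≠ 0) {x xt xb p q : E}
    (hx : IsSubgrad g (-gradient f xt - G (x - xt) - p) x)
    (hb : IsSubgrad g (-gradient f xb - q) xb) :
    (1 / 2) * qf L (xt - x) - qf U (xt - x) + (2 - ρ) * qf G (xt - x) + 2 * ⟪x - xb, p - q⟫_ℝ ≤
      (1 / ρ) * qf G (xt - xb) - (1 / ρ) * qf G (xt + ρ • (x - xt) - xb) := by
  have h₁ := hx.inner_sub_nonneg_s15 hb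
  have h₂ := le_inner_gradient_sub hL hlow hupp x xt xb
  rw [qf_relaxation hG hρ]
  have h₃ : -gradient f xt - G (x - xt) - p - (-gradient f xb - q) =
      G (xt - x) - (gradient f xt - gradient f xb) - (p - q) := by
    simp only [map_sub]
    abel
  rw [h₃, inner_sub_right, inner_sub_right] at h₁
  linarith

lemma multiplier_identity {σ ρ : ℝ} (hσ : σ ≠ 0) (hρ : ρ ≠ 0) {a a' b z z' : E}
    (hz : z' = z + (σ * (ρ - 1)) • a + σ • a' + (σ * ρ) • b) :
    (1 / (σ * ρ)) * ‖z + (σ * (ρ - 1)) • a‖ ^ 2 + σ * (2 - ρ) * ‖a‖ ^ 2 -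
        ((1 / (σ * ρ)) * ‖z' + (σ * (ρ - 1)) • a'‖ ^ 2 + σ * (2 - ρ) * ‖a'‖ ^ 2) +
        2 * ⟪a', z'⟫_ℝ + 2 * ⟪b, z + σ • (a + b)⟫_ℝ =
      σ * (2 - ρ) * ‖a + b‖ ^ 2 := by
  subst hz
  simp only [← real_inner_self_eq_norm_sq, inner_add_left, inner_add_right, inner_smul_left,
    inner_smul_right, RCLike.conj_to_real, real_inner_comm a' a, real_inner_comm b a,
    real_inner_comm b a', real_inner_comm z a, real_inner_comm z a', real_inner_comm z b,
    smul_add]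
  field_simp
  ring

lemma half_norm_sub_sq_le (a b b' : E) :
    (1 / 2) * ‖b - b'‖ ^ 2 ≤ ‖a + b‖ ^ 2 + ‖a + b'‖ ^ 2 := by
  have h := parallelogram_law_with_norm ℝ (a + b) (a + b')
  rw [add_sub_add_left_eq_sub] at h
  nlinarith [sq_nonneg ‖a + b + (a + b')‖]

/-- If `-F ⪯ F - Γ ⪯ F`, the cross term of `F - Γ` is dominated by the quadratic form of `F`. -/
lemma qf_add_cross_nonneg {F Γ : E →L[ℝ] E} (hΓs : ∀ u v, ⟪Γ u, v⟫_ℝ = ⟪u, Γ v⟫_ℝ)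
    (hFs : ∀ u v, ⟪F u, v⟫_ℝ = ⟪u, F v⟫_ℝ) (hΓ : ∀ u, 0 ≤ qf Γ u)
    (hF : ∀ u, qf Γ u ≤ 2 * qf F u) (d e : E) :
    0 ≤ qf F e + qf F d + 2 * (⟪d, F e⟫_ℝ - ⟪d, Γ e⟫_ℝ) := by
  have h₁ := hF (d + e)
  have h₂ := hΓ (d - e)
  have h₃ : ⟪e, F d⟫_ℝ = ⟪d, F e⟫_ℝ := by rw [← hFs, real_inner_comm]
  have h₄ : ⟪e, Γ d⟫_ℝ = ⟪d, Γ e⟫_ℝ := by rw [← hΓs, real_inner_comm]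
  simp only [qf, map_sub, map_add, inner_sub_left, inner_sub_right, inner_add_left,
    inner_add_right, h₃, h₄] at *
  linarith

end Helpers

theorem stmt_15 {X Y Z : Type*}
    [NormedAddCommGroup X] [InnerProductSpace ℝ X] [FiniteDimensional ℝ X]
    [NormedAddCommGroup Y] [InnerProductSpace ℝ Y] [FiniteDimensional ℝ Y]
    [NormedAddCommGroup Z] [InnerProductSpace ℝ Z] [FiniteDimensional ℝ Z]
    (f1 f2 : X → ℝ) (h1 h2 : Y → ℝ)
    (hf1c : ConvexOn ℝ Set.univ f1) (hf1d : Differentiable ℝ f1)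
    (hh1c : ConvexOn ℝ Set.univ h1) (hh1d : Differentiable ℝ h1)
    (hf2c : ConvexOn ℝ Set.univ f2) (hh2c : ConvexOn ℝ Set.univ h2)
    (Sf Sfh : X →L[ℝ] X) (Sh Shh : Y →L[ℝ] Y)
    (hSfsa : ∀ u v : X, ⟪Sf u, v⟫_ℝ = ⟪u, Sf v⟫_ℝ)
    (hSfhsa : ∀ u v : X, ⟪Sfh u, v⟫_ℝ = ⟪u, Sfh v⟫_ℝ)
    (hShsa : ∀ u v : Y, ⟪Sh u, v⟫_ℝ = ⟪u, Sh v⟫_ℝ)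
    (hShhsa : ∀ u v : Y, ⟪Shh u, v⟫_ℝ = ⟪u, Shh v⟫_ℝ)
    (hSfpsd : ∀ u : X, 0 ≤ ⟪u, Sf u⟫_ℝ) (hSfhpsd : ∀ u : X, 0 ≤ ⟪u, Sfh u⟫_ℝ)
    (hShpsd : ∀ u : Y, 0 ≤ ⟪u, Sh u⟫_ℝ) (hShhpsd : ∀ u : Y, 0 ≤ ⟪u, Shh u⟫_ℝ)
    (hfle : ∀ u : X, 0 ≤ ⟪u, (Sfh - Sf) u⟫_ℝ)
    (hhle : ∀ u : Y, 0 ≤ ⟪u, (Shh - Sh) u⟫_ℝ)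
    (hflow : ∀ x x' : X,
      (1 / 2) * qf Sf (x - x') ≤ f1 x - f1 x' - ⟪x - x', gradient f1 x'⟫_ℝ)
    (hfupp : ∀ x x' : X,
      f1 x - f1 x' - ⟪x - x', gradient f1 x'⟫_ℝ ≤ (1 / 2) * qf Sfh (x - x'))
    (hhlow : ∀ y y' : Y,
      (1 / 2) * qf Sh (y - y') ≤ h1 y - h1 y' - ⟪y - y', gradient h1 y'⟫_ℝ)
    (hhupp : ∀ y y' : Y,
      h1 y - h1 y' - ⟪y - y', gradient h1 y'⟫_ℝ ≤ (1 / 2) * qf Shh (y - y'))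
    (A : Z →L[ℝ] X) (As : X →L[ℝ] Z) (B : Z →L[ℝ] Y) (Bs : Y →L[ℝ] Z)
    (hA : ∀ (zz : Z) (xx : X), ⟪A zz, xx⟫_ℝ = ⟪zz, As xx⟫_ℝ)
    (hB : ∀ (zz : Z) (yy : Y), ⟪B zz, yy⟫_ℝ = ⟪zz, Bs yy⟫_ℝ)
    (c : Z) (σ ρ : ℝ) (hσ : 0 < σ) (hρ : ρ ∈ Set.Ioo (0 : ℝ) 2)
    (S : X →L[ℝ] X) (T : Y →L[ℝ] Y)
    (hSsa : ∀ u v : X, ⟪S u, v⟫_ℝ = ⟪u, S v⟫_ℝ)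
    (hTsa : ∀ u v : Y, ⟪T u, v⟫_ℝ = ⟪u, T v⟫_ℝ)
    (hSpsd : ∀ u : X, 0 ≤ ⟪u, S u⟫_ℝ) (hTpsd : ∀ u : Y, 0 ≤ ⟪u, T u⟫_ℝ)
    (x xt : ℕ → X) (y yt : ℕ → Y) (z zt : ℕ → Z)
    (hfocx : ∀ k, IsSubgrad f2
      (-gradient f1 (xt k) - (Sfh + S) (x k - xt k) - A (z k)) (x k))
    (hzdef : ∀ k, z k = zt k + σ • (As (x k) + Bs (yt k) - c))
    (hfocy : ∀ k, IsSubgrad h2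
      (-gradient h1 (yt k) - (Shh + T) (y k - yt k) -
        B (z k + σ • (As (x k) + Bs (y k) - c))) (y k))
    (hxt : ∀ k, xt (k + 1) = xt k + ρ • (x k - xt k))
    (hyt : ∀ k, yt (k + 1) = yt k + ρ • (y k - yt k))
    (hzt : ∀ k, zt (k + 1) = zt k + ρ • (z k - zt k))
    (xb : X) (yb : Y) (zb : Z)
    (hkkt1 : IsSubgrad f2 (-gradient f1 xb - A zb) xb)
    (hkkt2 : IsSubgrad h2 (-gradient h1 yb - B zb) yb)
    (hkkt3 : As xb + Bs yb = c)
    (hhalf : ∀ u : X, 0 ≤ ⟪u, ((1 / 2 : ℝ) • Sfh + S) u⟫_ℝ)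
    (Γ : ℕ → X →L[ℝ] X)
    (hΓsa : ∀ k, ∀ u v : X, ⟪Γ k u, v⟫_ℝ = ⟪u, Γ k v⟫_ℝ)
    (hΓpsd : ∀ k, ∀ u : X, 0 ≤ ⟪u, Γ k u⟫_ℝ)
    (hΓle : ∀ k, ∀ u : X, 0 ≤ ⟪u, (Sfh - Γ k) u⟫_ℝ)
    (hΓgrad : ∀ k,
      gradient f1 (xt (k + 1)) - gradient f1 (xt k) = Γ k (xt (k + 1) - xt k)) :
    ∀ lam ∈ Set.Ioc (0 : ℝ) 1, ∀ k ≥ 1,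
      (((1 / (σ * ρ)) * ‖(z k - zb) + (σ * (ρ - 1)) • As (x k - xb)‖ ^ 2 +
          σ * (2 - ρ) * ‖As (x k - xb)‖ ^ 2 +
          (1 / ρ) * qf (Sfh + S) (xt (k + 1) - xb) +
          (1 / ρ) * qf (Shh + T) (yt k - yb)) +
        (2 - ρ) * qf (Sfh + S) (xt k - x k) +
        σ * (1 - lam) * (2 - ρ) * ‖As (x k) + Bs (y (k - 1)) - c‖ ^ 2) -
      (((1 / (σ * ρ)) * ‖(z (k + 1) - zb) + (σ * (ρ - 1)) • As (x (k + 1) - xb)‖ ^ 2 +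
          σ * (2 - ρ) * ‖As (x (k + 1) - xb)‖ ^ 2 +
          (1 / ρ) * qf (Sfh + S) (xt (k + 2) - xb) +
          (1 / ρ) * qf (Shh + T) (yt (k + 1) - yb)) +
        (2 - ρ) * qf (Sfh + S) (xt (k + 1) - x (k + 1)) +
        σ * (1 - lam) * (2 - ρ) * ‖As (x (k + 1)) + Bs (y k) - c‖ ^ 2) ≥
      (qf ((1 / 2 : ℝ) • Sf) (xt (k + 1) - x (k + 1)) +
        qf ((1 / 2 : ℝ) • Sh + (2 - ρ) • (Shh + T)) (yt k - y k) +
        (1 - lam) * (2 - ρ) * qf (Sfh + S) (xt k - x k) +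
        σ * (2 * lam - 1) * (2 - ρ) * ‖As (x (k + 1)) + Bs (y k) - c‖ ^ 2 +
        (σ * (1 - lam) * (2 - ρ) / 2) * ‖Bs (y k - y (k - 1))‖ ^ 2 +
        (lam * (2 - ρ) ^ 2 / ρ) *
          qf (Sfh + S + σ • (A.comp As)) (x (k + 1) - x k)) -
      (qf Sfh (xt (k + 1) - x (k + 1)) + qf Shh (yt k - y k)) := by
  rintro lam ⟨hl0, hl1⟩ k -
  obtain ⟨hρ0, hρ2⟩ := hρ
  have hFs : ∀ u v : X, ⟪(Sfh + S) u, v⟫_ℝ = ⟪u, (Sfh + S) v⟫_ℝ := fun u v => by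
    simp [inner_add_left, inner_add_right, hSfhsa, hSsa]
  have hHs : ∀ u v : Y, ⟪(Shh + T) u, v⟫_ℝ = ⟪u, (Shh + T) v⟫_ℝ := fun u v => by
    simp [inner_add_left, inner_add_right, hShhsa, hTsa]
  have hA' (u : X) (w : Z) : ⟪u, A w⟫_ℝ = ⟪As u, w⟫_ℝ := by
    rw [real_inner_comm, hA, real_inner_comm]
  have hB' (u : Y) (w : Z) : ⟪u, B w⟫_ℝ = ⟪Bs u, w⟫_ℝ := by
    rw [real_inner_comm, hB, real_inner_comm]
  have hres (u : X) (v : Y) : As u + Bs v - c = As (u - xb) + Bs (v - yb) := by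
    rw [← hkkt3, map_sub, map_sub]
    abel
  have hzstep : z (k + 1) = z k + (σ * (ρ - 1)) • As (x k - xb) + σ • As (x (k + 1) - xb) +
      (σ * ρ) • Bs (y k - yb) := by
    have hzk := hzdef k
    rw [hzdef (k + 1), hzt, hyt, hzk, ← hkkt3]
    simp only [map_add, map_sub, map_smul]
    module
  have hxstep := prox_step_le hSfpsd hflow hfupp hFs hρ0.ne' (hfocx (k + 1)) hkkt1
  have hystep := prox_step_le hShpsd hhlow hhupp hHs hρ0.ne' (hfocy k) hkkt2
  rw [← map_sub, hA', ← hxt, show k + 1 + 1 = k + 2 from rfl] at hxstep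
  rw [← map_sub, hB', ← hyt, hres] at hystep
  have hmono := (hfocx (k + 1)).inner_sub_nonneg_s15 (hfocx k)
  have hxt' : xt (k + 1) - xt k = -ρ • (xt k - x k) := by
    rw [hxt]
    module
  have hdiff : -gradient f1 (xt (k + 1)) - (Sfh + S) (x (k + 1) - xt (k + 1)) - A (z (k + 1)) -
      (-gradient f1 (xt k) - (Sfh + S) (x k - xt k) - A (z k)) =
      ρ • Γ k (xt k - x k) - (Sfh + S) (x (k + 1) - x k) - ρ • (Sfh + S) (xt k - x k) -
        A (z (k + 1) - z k) := by
    have h := hΓgrad k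
    rw [hxt', map_smul] at h
    have h' : gradient f1 (xt (k + 1)) = gradient f1 (xt k) + -ρ • Γ k (xt k - x k) := by
      rw [← h]
      abel
    rw [h', hxt]
    simp only [map_add, map_sub, map_smul]
    module
  have hcross := qf_add_cross_nonneg (hΓsa k) hFs (hΓpsd k) (fun u => by
    have h₁ := hΓle k u
    have h₂ := hhalf u
    simp only [sub_apply, add_apply,
      smul_apply, inner_sub_right, inner_add_right, inner_smul_right] at h₁ h₂
    simp only [qf, add_apply, inner_add_right]
    linarith) (x (k + 1) - x k) (xt k - x k)
  rw [hdiff, inner_sub_right, inner_sub_right, inner_sub_right, inner_smul_right,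
    inner_smul_right, hA'] at hmono
  have hmult := multiplier_identity hσ.ne' hρ0.ne' (a := As (x k - xb))
    (a' := As (x (k + 1) - xb)) (b := Bs (y k - yb)) (z := z k - zb) (z' := z (k + 1) - zb)
    (by rw [hzstep]; abel)
  have hpar := half_norm_sub_sq_le (As (x k - xb)) (Bs (y k - yb)) (Bs (y (k - 1) - yb))
  rw [← map_sub, sub_sub_sub_cancel_right] at hpar
  have hzb : z k + σ • (As (x k - xb) + Bs (y k - yb)) - zb =
      z k - zb + σ • (As (x k - xb) + Bs (y k - yb)) := by abel
  rw [hzb] at hystep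
  have hp : As (x (k + 1) - x k) = As (x (k + 1) - xb) - As (x k - xb) := by
    rw [← map_sub, sub_sub_sub_cancel_right]
  have hzd : z (k + 1) - z k = σ • (As (x (k + 1) - xb) - As (x k - xb)) +
      (σ * ρ) • (As (x k - xb) + Bs (y k - yb)) := by
    rw [hzstep]
    module
  have hqA : qf (Sfh + S + σ • A.comp As) (x (k + 1) - x k) =
      qf (Sfh + S) (x (k + 1) - x k) + σ * ‖As (x (k + 1) - xb) - As (x k - xb)‖ ^ 2 := by
    rw [qf_add_apply, qf_smul_apply, ← hp, ← real_inner_self_eq_norm_sq, ← hA']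
    rfl
  have hexp : ‖As (x (k + 1) - xb) + Bs (y k - yb)‖ ^ 2 =
      ‖As (x (k + 1) - xb) - As (x k - xb)‖ ^ 2 +
      2 * ⟪As (x (k + 1) - xb) - As (x k - xb), As (x k - xb) + Bs (y k - yb)⟫_ℝ +
      ‖As (x k - xb) + Bs (y k - yb)‖ ^ 2 := by
    rw [← norm_add_sq_real]
    congr 2
    abel
  rw [hp, hzd, inner_add_right, inner_smul_right, inner_smul_right,
    real_inner_self_eq_norm_sq] at hmono
  have hdescent : (2 - ρ) / ρ * qf (Sfh + S + σ • A.comp As) (x (k + 1) - x k) ≤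
      qf (Sfh + S) (xt k - x k) + σ * ‖As (x k - xb) + Bs (y k - yb)‖ ^ 2 -
        σ * ‖As (x (k + 1) - xb) + Bs (y k - yb)‖ ^ 2 := by
    rw [hqA, hexp, div_mul_eq_mul_div, div_le_iff₀ hρ0]
    have h := mul_nonneg hρ0.le hcross
    change 0 ≤ _ - qf (Sfh + S) (x (k + 1) - x k) - _ - _ at hmono
    linarith
  have h₁ := mul_le_mul_of_nonneg_left hdescent (mul_nonneg hl0.le (sub_nonneg.2 hρ2.le))
  have h₂ := mul_le_mul_of_nonneg_left hpar
    (mul_nonneg (mul_nonneg hσ.le (sub_nonneg.2 hl1)) (sub_nonneg.2 hρ2.le))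
  have h₃ : lam * (2 - ρ) ^ 2 / ρ = lam * (2 - ρ) * ((2 - ρ) / ρ) := by ring
  rw [hres, hres, h₃]
  simp only [qf_add_apply ((1 / 2 : ℝ) • Sh), qf_smul_apply]
  linarith
end
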